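/- Let 𝒢 be a finite groupoid and A a unital 𝒢-graded algebra over a field k. Then there is an isomorphism of algebras (A # k𝒢*) *_γ 𝒢 ≅ End((A # k𝒢*)_{A #_λ^𝒢 O^𝒢}), where X = {v_g : g∈𝒢} is the split (𝒢_α,𝒢_β)-set with α_g(v_h)=v_{gh} on X_g = {v_h : r(h)=r(g)} and β_g(v_h)=v_{hg⁻¹} on Y_g = {v_h : d(h)=r(g)}, γ is the induced action of 𝒢 on A # k𝒢* ≅ A #_α^𝒢 X, O^𝒢 is the set of β-orbits of X with its induced 𝒢-action λ, and End denotes endomorphisms of A # k𝒢* as a right A #_λ^𝒢 O^𝒢-module via the embedding induced by the orbit map. -/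

import Mathlib

open scoped Classical

noncomputable section

universe u v w

/-- A groupoid, presented as a set of morphisms with partially defined
composition.  `s g` is the domain (source) identity `d(g)`, `t g` the range
(target) identity `r(g)`; `mul g h` is the composite `gh`, meaningful when
`s g = t h`. -/
structure Gpd (G : Type u) where
  s : G → G
  t : G → G
  inv : G → G
  mul : G → G → G
  s_s : ∀ g, s (s g) = s g
  t_s : ∀ g, t (s g) = s g
  s_t : ∀ g, s (t g) = t g
  t_t : ∀ g, t (t g) = t g
  s_mul : ∀ g h, s g = t h → s (mul g h) = s h
  t_mul : ∀ g h, s g = t h → t (mul g h) = t g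
  mul_assoc : ∀ g h l, s g = t h → s h = t l → mul (mul g h) l = mul g (mul h l)
  mul_src : ∀ g, mul g (s g) = g
  tgt_mul : ∀ g, mul (t g) g = g
  s_inv : ∀ g, s (inv g) = t g
  t_inv : ∀ g, t (inv g) = s g
  inv_mul : ∀ g, mul (inv g) g = s g
  mul_inv : ∀ g, mul g (inv g) = t g

namespace Gpd

variable {G : Type u}

/-- `e` is an object (identity) of the groupoid. -/
def obj (𝒢 : Gpd G) (e : G) : Prop := 𝒢.s e = e

/-- The set `𝒢₀` of objects of the groupoid. -/
def Objs (𝒢 : Gpd G) : Set G := {e | 𝒢.obj e}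

end Gpd

/-- An action `α = (X_g, α_g)` of a groupoid `𝒢` on a set `X`:
`car g` is the subset `X_g` and `act g` restricts to the bijection
`α_g : X_{g⁻¹} → X_g`. -/
structure GpdSetAction {G : Type u} (𝒢 : Gpd G) (X : Type v) where
  car : G → Set X
  act : G → X → X
  car_t : ∀ g, car g = car (𝒢.t g)
  bijOn : ∀ g, Set.BijOn (act g) (car (𝒢.inv g)) (car g)
  act_id : ∀ e, 𝒢.obj e → ∀ x ∈ car e, act e x = x
  act_mul : ∀ g h, 𝒢.s g = 𝒢.t h → ∀ x ∈ car (𝒢.inv h),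
    act g (act h x) = act (𝒢.mul g h) x

/-- `X` is a split `𝒢`-set: `X` is the disjoint union of the `X_e`, `e ∈ 𝒢₀`. -/
def GpdSetAction.Split {G : Type u} {𝒢 : Gpd G} {X : Type v} (α : GpdSetAction 𝒢 X) : Prop :=
  ∀ x : X, ∃! e : G, 𝒢.obj e ∧ x ∈ α.car e

/-- The action is fully faithful: if `α_g` fixes some `x ∈ X_g ∩ X_{g⁻¹}`
then `g` is an identity. -/
def GpdSetAction.FullyFaithful {G : Type u} {𝒢 : Gpd G} {X : Type v}
    (α : GpdSetAction 𝒢 X) : Prop :=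
  ∀ g x, x ∈ α.car g ∩ α.car (𝒢.inv g) → α.act g x = x → 𝒢.obj g

/-- A `𝒢`-grading of the `k`-algebra `A`:  `A = ⊕_{g ∈ 𝒢} A_g` with
`A_g A_h ⊆ A_{gh}` for composable `g, h` and `A_g A_h = 0` otherwise. -/
structure GpdGrading {G : Type u} (𝒢 : Gpd G) (k : Type v) (A : Type w)
    [Field k] [Ring A] [Algebra k A] where
  comp : G → Submodule k A
  internal : DirectSum.IsInternal comp
  mul_mem : ∀ g h, 𝒢.s g = 𝒢.t h → ∀ a ∈ comp g, ∀ b ∈ comp h, a * b ∈ comp (𝒢.mul g h)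
  mul_eq_zero : ∀ g h, 𝒢.s g ≠ 𝒢.t h → ∀ a ∈ comp g, ∀ b ∈ comp h, a * b = 0

/-- The homogeneous component of degree `g` of `a ∈ A`. -/
noncomputable def GpdGrading.proj {G : Type u} {𝒢 : Gpd G} {k : Type v} {A : Type w}
    [Field k] [Ring A] [Algebra k A] (𝒜 : GpdGrading 𝒢 k A) (g : G) (a : A) : A :=
  ((Equiv.ofBijective _ 𝒜.internal).symm a g : A)

/-- `one : G → A` is a family of local units for the grading: each `one e`
(`e ∈ 𝒢₀`) is an identity element of `A_e` and `1_A = Σ_{e ∈ 𝒢₀} 1_e`. -/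
def IsIdFamily {G : Type u} {𝒢 : Gpd G} {k : Type v} {A : Type w}
    [Field k] [Ring A] [Algebra k A] (𝒜 : GpdGrading 𝒢 k A) (one : G → A) : Prop :=
  (∀ e, 𝒢.obj e → one e ∈ 𝒜.comp e ∧ ∀ a ∈ 𝒜.comp e, one e * a = a ∧ a * one e = a) ∧
  (1 : A) = ∑ᶠ e ∈ 𝒢.Objs, one e

/-- The multiplication of the smash product `A #_α^𝒢 X`, defined on the
ambient space of formal sums `Σ a_{(g,x)} δ_{(g,x)}`:
`(a δ_{(g,x)}) (b δ_{(h,y)}) = (a b) δ_{(gh, y)}` when `d(g) = r(h)` and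
`α_h(y) = x`, and `0` otherwise. -/
noncomputable def smashMul {G : Type u} {𝒢 : Gpd G} {X : Type v} {A : Type w} [Ring A]
    (α : GpdSetAction 𝒢 X) (f₁ f₂ : (G × X) →₀ A) : (G × X) →₀ A :=
  f₁.sum fun p a => f₂.sum fun q b =>
    if 𝒢.s p.1 = 𝒢.t q.1 ∧ α.act q.1 q.2 = p.2
    then Finsupp.single (𝒢.mul p.1 q.1, q.2) (a * b) else 0

/-- The underlying set of the smash product `A #_α^𝒢 X = ⊕_{g} ⊕_{x ∈ X_{d(g)}} A_g δ_x`: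
those formal sums whose `(g,x)`-coefficient lies in `A_g`, supported on pairs
with `x ∈ X_{d(g)}`. -/
def smashSet {G : Type u} {𝒢 : Gpd G} {X : Type v} {k : Type*} {A : Type w}
    [Field k] [Ring A] [Algebra k A]
    (α : GpdSetAction 𝒢 X) (𝒜 : GpdGrading 𝒢 k A) : Set ((G × X) →₀ A) :=
  {f | ∀ p : G × X, f p ∈ 𝒜.comp p.1 ∧ (f p ≠ 0 → p.2 ∈ α.car (𝒢.s p.1))}

/-- The identity element `Σ_{e ∈ 𝒢₀} Σ_{x ∈ X_e} 1_e δ_x` of the smash product. -/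
noncomputable def smashOne {G : Type u} {𝒢 : Gpd G} {X : Type v} {A : Type w} [Ring A]
    (α : GpdSetAction 𝒢 X) (one : G → A) : (G × X) →₀ A :=
  ∑ᶠ e ∈ 𝒢.Objs, ∑ᶠ x ∈ α.car e, Finsupp.single ((e, x) : G × X) (one e)

/-- `X` is a `(𝒢_α, 𝒦_β)`-set:  each `Y_k` is `α`-invariant, each `X_g` is
`β`-invariant, and the two actions commute. -/
structure GKCompat {G : Type u} {K : Type*} {𝒢 : Gpd G} {𝒦 : Gpd K} {X : Type v}
    (α : GpdSetAction 𝒢 X) (β : GpdSetAction 𝒦 X) : Prop where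
  alpha_inv : ∀ g κ, α.act g '' (α.car (𝒢.inv g) ∩ β.car κ) ⊆ α.car g ∩ β.car κ
  beta_inv : ∀ g κ, β.act κ '' (α.car g ∩ β.car (𝒦.inv κ)) ⊆ α.car g ∩ β.car κ
  comm : ∀ g κ x, x ∈ α.car (𝒢.inv g) ∩ β.car (𝒦.inv κ) →
    α.act g (β.act κ x) = β.act κ (α.act g x)

/-- The ideal `E_k = A #^𝒢_{θ^k} Y_k = ⊕_g ⊕_{x ∈ Y_k ∩ X_{d(g)}} A_g δ_x`
of the smash product `A #_α^𝒢 X`. -/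
def Eset {G : Type u} {K : Type*} {𝒢 : Gpd G} {𝒦 : Gpd K} {X : Type v}
    {k : Type*} {A : Type w} [Field k] [Ring A] [Algebra k A]
    (α : GpdSetAction 𝒢 X) (β : GpdSetAction 𝒦 X) (𝒜 : GpdGrading 𝒢 k A)
    (κ : K) : Set ((G × X) →₀ A) :=
  {f | f ∈ smashSet α 𝒜 ∧ ∀ p : G × X, f p ≠ 0 → p.2 ∈ β.car κ}

/-- The map `γ_k : E_{k⁻¹} → E_k`, `γ_k(a_g δ_y) = a_g δ_{β_k(y)}`. -/
noncomputable def gammaAct {G : Type u} {K : Type*} {𝒦 : Gpd K} {X : Type v} {A : Type w}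
    [Ring A] (β : GpdSetAction 𝒦 X) (κ : K) (f : (G × X) →₀ A) : (G × X) →₀ A :=
  f.sum fun p a =>
    if p.2 ∈ β.car (𝒦.inv κ) then Finsupp.single ((p.1, β.act κ p.2) : G × X) a else 0

/-- The identity element `𝟏_k = Σ_{e ∈ 𝒢₀} Σ_{x ∈ Y_k ∩ X_e} 1_e δ_x` of `E_k`. -/
noncomputable def OneE {G : Type u} {K : Type*} {𝒢 : Gpd G} {𝒦 : Gpd K} {X : Type v}
    {A : Type w} [Ring A]
    (α : GpdSetAction 𝒢 X) (β : GpdSetAction 𝒦 X) (one : G → A) (κ : K) : (G × X) →₀ A :=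
  ∑ᶠ e ∈ 𝒢.Objs, ∑ᶠ x ∈ (β.car κ ∩ α.car e), Finsupp.single ((e, x) : G × X) (one e)

/-- The `𝒦`-orbit `o(x) = {β_k(x) : k ∈ D_p}` of `x ∈ Y_p`. -/
def orbit {K : Type*} {𝒦 : Gpd K} {X : Type v} (β : GpdSetAction 𝒦 X) (x : X) : Set X :=
  {y | ∃ κ, x ∈ β.car (𝒦.inv κ) ∧ β.act κ x = y}

/-- The set `O^𝒦` of `𝒦`-orbits of `X`. -/
abbrev OrbT {K : Type*} {𝒦 : Gpd K} {X : Type v} (β : GpdSetAction 𝒦 X) : Type v :=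
  {o : Set X // ∃ x, orbit β x = o}

/-- The orbit map `φ : X → O^𝒦`, `φ(x) = o(x)`. -/
def orbMap {K : Type*} {𝒦 : Gpd K} {X : Type v} (β : GpdSetAction 𝒦 X) (x : X) : OrbT β :=
  ⟨orbit β x, ⟨x, rfl⟩⟩

/-- The monomorphism `φ* : A #_λ^𝒢 O^𝒦 → A #_α^𝒢 X` induced by the orbit map,
`φ*(a_g δ_{o(x)}) = Σ_{y ∈ X_{d(g)}, o(y) = o(x)} a_g δ_y`. -/
noncomputable def phiStar {G : Type u} {K : Type*} {𝒢 : Gpd G} {𝒦 : Gpd K} {X : Type v}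
    {A : Type w} [Ring A] (α : GpdSetAction 𝒢 X) (β : GpdSetAction 𝒦 X)
    (f : (G × OrbT β) →₀ A) : (G × X) →₀ A :=
  f.sum fun p a =>
    ∑ᶠ y ∈ {y | y ∈ α.car (𝒢.s p.1) ∧ orbit β y = (p.2 : Set X)},
      Finsupp.single ((p.1, y) : G × X) a

/-- The subalgebra of invariants `(A #_α^𝒢 X)^γ`:  all `b` in the smash
product with `γ_k(b 𝟏_{k⁻¹}) = b 𝟏_k` for every `k ∈ 𝒦`. -/
noncomputable def invariantSet {G : Type u} {K : Type*} {𝒢 : Gpd G} {𝒦 : Gpd K} {X : Type v}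
    {k : Type*} {A : Type w} [Field k] [Ring A] [Algebra k A]
    (α : GpdSetAction 𝒢 X) (β : GpdSetAction 𝒦 X) (𝒜 : GpdGrading 𝒢 k A)
    (one : G → A) : Set ((G × X) →₀ A) :=
  {f | f ∈ smashSet α 𝒜 ∧ ∀ κ : K,
    gammaAct β κ (smashMul α f (OneE α β one (𝒦.inv κ))) = smashMul α f (OneE α β one κ)}

/-- The multiplication of the skew groupoid ring `(A #_α^𝒢 X) *_γ 𝒦`,
given on formal sums `Σ_k x_k δ_k` (with `x_k ∈ E_k`) by
`(x δ_k)(y δ_l) = x γ_k(y) δ_{kl}` when `d(k) = r(l)` and `0` otherwise. -/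
noncomputable def skewMul {G : Type u} {K : Type*} {𝒢 : Gpd G} {𝒦 : Gpd K} {X : Type v}
    {A : Type w} [Ring A] (α : GpdSetAction 𝒢 X) (β : GpdSetAction 𝒦 X)
    (F₁ F₂ : K →₀ ((G × X) →₀ A)) : K →₀ ((G × X) →₀ A) :=
  F₁.sum fun κ x => F₂.sum fun l y =>
    if 𝒦.s κ = 𝒦.t l then Finsupp.single (𝒦.mul κ l) (smashMul α x (gammaAct β κ y)) else 0

/-- The underlying set of the skew groupoid ring
`(A #_α^𝒢 X) *_γ 𝒦 = ⊕_{k ∈ 𝒦} E_k δ_k`. -/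
def skewSet {G : Type u} {K : Type*} {𝒢 : Gpd G} {𝒦 : Gpd K} {X : Type v}
    {k : Type*} {A : Type w} [Field k] [Ring A] [Algebra k A]
    (α : GpdSetAction 𝒢 X) (β : GpdSetAction 𝒦 X) (𝒜 : GpdGrading 𝒢 k A) :
    Set (K →₀ ((G × X) →₀ A)) :=
  {F | ∀ κ, F κ ∈ Eset α β 𝒜 κ}

/-- `F` represents an endomorphism of `A #_α^𝒢 X` as a right
`A #_λ^𝒢 O^𝒦`-module (the right action being given through the embedding
`φ*`). -/
def IsRModEnd {G : Type u} {K : Type*} {𝒢 : Gpd G} {𝒦 : Gpd K} {X : Type v}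
    {k : Type*} {A : Type w} [Field k] [Ring A] [Algebra k A]
    (α : GpdSetAction 𝒢 X) (β : GpdSetAction 𝒦 X) (𝒜 : GpdGrading 𝒢 k A)
    (lam : GpdSetAction 𝒢 (OrbT β))
    (F : ((G × X) →₀ A) → ((G × X) →₀ A)) : Prop :=
  (∀ f ∈ smashSet α 𝒜, F f ∈ smashSet α 𝒜) ∧
  (∀ f₁ ∈ smashSet α 𝒜, ∀ f₂ ∈ smashSet α 𝒜, F (f₁ + f₂) = F f₁ + F f₂) ∧
  (∀ (c : k), ∀ f ∈ smashSet α 𝒜, F (c • f) = c • F f) ∧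
  (∀ f ∈ smashSet α 𝒜, ∀ w ∈ smashSet lam 𝒜,
    F (smashMul α f (phiStar α β w)) = smashMul α (F f) (phiStar α β w))

/-- There is an isomorphism of algebras
`(A #_α^𝒢 X) *_γ 𝒦 ≅ End((A #_α^𝒢 X)_{A #_λ^𝒢 O^𝒦})`. -/
def SmashDuality {G : Type u} {K : Type*} {𝒢 : Gpd G} {𝒦 : Gpd K} {X : Type v}
    (k : Type*) {A : Type w} [Field k] [Ring A] [Algebra k A]
    (α : GpdSetAction 𝒢 X) (β : GpdSetAction 𝒦 X) (𝒜 : GpdGrading 𝒢 k A)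
    (lam : GpdSetAction 𝒢 (OrbT β)) : Prop :=
  ∃ Ψ : (K →₀ ((G × X) →₀ A)) → ((G × X) →₀ A) → ((G × X) →₀ A),
    -- Ψ maps the skew groupoid ring into the endomorphism algebra
    (∀ F ∈ skewSet α β 𝒜, IsRModEnd α β 𝒜 lam (Ψ F)) ∧
    -- Ψ is k-linear
    (∀ F₁ ∈ skewSet α β 𝒜, ∀ F₂ ∈ skewSet α β 𝒜, ∀ f ∈ smashSet α 𝒜,
      Ψ (F₁ + F₂) f = Ψ F₁ f + Ψ F₂ f) ∧
    (∀ (c : k), ∀ F ∈ skewSet α β 𝒜, ∀ f ∈ smashSet α 𝒜, Ψ (c • F) f = c • Ψ F f) ∧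
    -- Ψ is multiplicative (composition of endomorphisms)
    (∀ F₁ ∈ skewSet α β 𝒜, ∀ F₂ ∈ skewSet α β 𝒜, ∀ f ∈ smashSet α 𝒜,
      Ψ (skewMul α β F₁ F₂) f = Ψ F₁ (Ψ F₂ f)) ∧
    -- Ψ is injective
    (∀ F₁ ∈ skewSet α β 𝒜, ∀ F₂ ∈ skewSet α β 𝒜,
      (∀ f ∈ smashSet α 𝒜, Ψ F₁ f = Ψ F₂ f) → F₁ = F₂) ∧
    -- Ψ is surjective onto the endomorphism algebra
    (∀ F : ((G × X) →₀ A) → ((G × X) →₀ A), IsRModEnd α β 𝒜 lam F →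
      ∃ Fs ∈ skewSet α β 𝒜, ∀ f ∈ smashSet α 𝒜, Ψ Fs f = F f)

/-- The underlying set of the weak smash product
`A # k𝒢* = ⊕_{d(g) = r(h)} A_g ⊗ v_h`:  an element is stored as the finitely
supported function `F : 𝒢 → A` sending `h` to the coefficient
`Σ_g a_g ∈ ⊕_{d(g) = r(h)} A_g` of `v_h`. -/
def weakSmashSet {G : Type u} {𝒢 : Gpd G} {k : Type*} {A : Type w}
    [Field k] [Ring A] [Algebra k A] (𝒜 : GpdGrading 𝒢 k A) : Set (G →₀ A) :=
  {F | ∀ h g, 𝒜.proj g (F h) ≠ 0 → 𝒢.s g = 𝒢.t h}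

/-- The multiplication of the weak smash product `A # k𝒢*`, induced by
`(a # u)(b # w) = a (u₁ · b) # u₂ w` for the weak Hopf algebra `k𝒢*`: on the
basis, `(a # v_h)(b # v_l) = a · (v_{h l⁻¹} · b) # v_l` if `d(h) = d(l)` and
`0` otherwise, where `v_m · b = b_m` is the `m`-homogeneous component. -/
noncomputable def weakSmashMul {G : Type u} {𝒢 : Gpd G} {k : Type*} {A : Type w}
    [Field k] [Ring A] [Algebra k A] (𝒜 : GpdGrading 𝒢 k A)
    (F₁ F₂ : G →₀ A) : G →₀ A :=
  F₂.sum fun l b => F₁.sum fun h a =>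
    if 𝒢.s h = 𝒢.s l then Finsupp.single l (a * 𝒜.proj (𝒢.mul h (𝒢.inv l)) b) else 0

/-- The map `ψ : A # k𝒢* → A #_α^𝒢 X`, `ψ(Σ a_g # v_h) = Σ a_g δ_{v_h}`,
where `X = {v_g : g ∈ 𝒢}` is identified with `𝒢` via `v_g ↦ g`. -/
noncomputable def weakToSmash {G : Type u} {𝒢 : Gpd G} {k : Type*} {A : Type w}
    [Field k] [Ring A] [Algebra k A] (𝒜 : GpdGrading 𝒢 k A)
    (F : G →₀ A) : (G × G) →₀ A :=
  F.sum fun h a => ∑ᶠ g : G, Finsupp.single ((g, h) : G × G) (𝒜.proj g a)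

section Helpers

namespace Gpd
variable {G : Type u} (𝒢 : Gpd G)

lemma gA {m l : G} (h : 𝒢.s m = 𝒢.t l) : 𝒢.mul (𝒢.mul m l) (𝒢.inv l) = m := by
  rw [𝒢.mul_assoc _ _ _ h (𝒢.t_inv l).symm, 𝒢.mul_inv, ← h, 𝒢.mul_src]

lemma gB {h l : G} (e : 𝒢.s h = 𝒢.s l) : 𝒢.mul (𝒢.mul h (𝒢.inv l)) l = h := by
  rw [𝒢.mul_assoc _ _ _ (by rw [𝒢.t_inv, e]) (𝒢.s_inv l), 𝒢.inv_mul, ← e, 𝒢.mul_src]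

lemma gC {h y : G} (e : 𝒢.s h = 𝒢.t y) : 𝒢.mul (𝒢.inv h) (𝒢.mul h y) = y := by
  rw [← 𝒢.mul_assoc _ _ _ (𝒢.s_inv h) e, 𝒢.inv_mul, e, 𝒢.tgt_mul]

lemma gD {h x : G} (e : 𝒢.t h = 𝒢.t x) : 𝒢.mul h (𝒢.mul (𝒢.inv h) x) = x := by
  rw [← 𝒢.mul_assoc _ _ _ (𝒢.t_inv h).symm (by rw [𝒢.s_inv, e]), 𝒢.mul_inv, e, 𝒢.tgt_mul]

end Gpd

namespace GpdGrading
variable {G : Type u} {𝒢 : Gpd G} {k : Type*} {A : Type w} [Field k] [Ring A] [Algebra k A]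
  (𝒜 : GpdGrading 𝒢 k A)

lemma proj_coe (d : DirectSum G fun g => 𝒜.comp g) (g : G) :
    𝒜.proj g (DirectSum.coeAddMonoidHom 𝒜.comp d) = d g := by
  unfold proj
  have : (Equiv.ofBijective _ 𝒜.internal).symm (DirectSum.coeAddMonoidHom 𝒜.comp d) = d :=
    (Equiv.ofBijective _ 𝒜.internal).symm_apply_apply d
  rw [this]

lemma exists_rep (a : A) : ∃ d : DirectSum G fun g => 𝒜.comp g,
    DirectSum.coeAddMonoidHom 𝒜.comp d = a := 𝒜.internal.2 a

lemma proj_add (g : G) (a b : A) : 𝒜.proj g (a + b) = 𝒜.proj g a + 𝒜.proj g b := by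
  obtain ⟨d, rfl⟩ := 𝒜.exists_rep a
  obtain ⟨d', rfl⟩ := 𝒜.exists_rep b
  rw [← map_add, proj_coe, proj_coe, proj_coe]; rfl

/-- `proj` as an additive map. -/
def projHom (g : G) : A →+ A := AddMonoidHom.mk' (𝒜.proj g) (𝒜.proj_add g)

lemma projHom_apply (g : G) (a : A) : 𝒜.projHom g a = 𝒜.proj g a := rfl

lemma proj_zero (g : G) : 𝒜.proj g 0 = 0 := (𝒜.projHom g).map_zero

lemma proj_mem (g : G) (a : A) : 𝒜.proj g a ∈ 𝒜.comp g := by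
  obtain ⟨d, rfl⟩ := 𝒜.exists_rep a
  rw [proj_coe]; exact (d g).2

lemma proj_of_mem {g : G} {a : A} (h : a ∈ 𝒜.comp g) (g' : G) :
    𝒜.proj g' a = if g' = g then a else 0 := by
  have : a = DirectSum.coeAddMonoidHom 𝒜.comp (DirectSum.of (fun g => 𝒜.comp g) g ⟨a, h⟩) := by
    simp
  conv_lhs => rw [this]
  rw [proj_coe]
  split_ifs with e
  · subst e; simp
  · rw [DirectSum.of_eq_of_ne _ _ _ e]; rfl

lemma sum_proj [Fintype G] (a : A) : ∑ g, 𝒜.proj g a = a := by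
  obtain ⟨d, rfl⟩ := 𝒜.exists_rep a
  simp only [proj_coe]
  rw [DirectSum.coeAddMonoidHom_eq_dfinsuppSum]
  rw [DFinsupp.sum_eq_sum_fintype]
  · rfl
  · intro; rfl

lemma proj_mul_left {g h : G} {a b : A} (ha : a ∈ 𝒜.comp g) (hb : b ∈ 𝒜.comp h) (hn : g ≠ 𝒢.t h) :
    𝒜.proj h (a * b) = 0 := by
  by_cases hc : 𝒢.s g = 𝒢.t h
  · rw [𝒜.proj_of_mem (𝒜.mul_mem _ _ hc _ ha _ hb), if_neg]
    intro e
    apply hn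
    rw [← 𝒢.gA hc, ← e, 𝒢.mul_inv]
  · rw [𝒜.mul_eq_zero _ _ hc _ ha _ hb, proj_zero]

lemma proj_mul_right {g h : G} {a b : A} (ha : a ∈ 𝒜.comp g) (hb : b ∈ 𝒜.comp h) (hn : h ≠ 𝒢.s g) :
    𝒜.proj g (a * b) = 0 := by
  by_cases hc : 𝒢.s g = 𝒢.t h
  · rw [𝒜.proj_of_mem (𝒜.mul_mem _ _ hc _ ha _ hb), if_neg]
    intro e
    apply hn
    rw [← 𝒢.gC hc, ← e, 𝒢.inv_mul]
  · rw [𝒜.mul_eq_zero _ _ hc _ ha _ hb, proj_zero]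

lemma unit_mul [Finite G] {h : G} {a : A} (ha : a ∈ 𝒜.comp h) : 𝒜.proj (𝒢.t h) 1 * a = a := by
  have := Fintype.ofFinite G
  have h1 : 𝒜.proj h ((∑ g, 𝒜.proj g 1) * a) = a := by
    rw [sum_proj, one_mul, 𝒜.proj_of_mem ha, if_pos rfl]
  rw [Finset.sum_mul, ← projHom_apply, map_sum, Finset.sum_eq_single (𝒢.t h)] at h1
  · rw [projHom_apply] at h1
    have := 𝒜.mul_mem _ _ (𝒢.s_t h) _ (𝒜.proj_mem (𝒢.t h) 1) _ ha
    rw [𝒢.tgt_mul] at this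
    rwa [𝒜.proj_of_mem this, if_pos rfl] at h1
  · intro g _ hg
    exact 𝒜.proj_mul_left (𝒜.proj_mem _ _) ha hg
  · simp

lemma mul_unit [Finite G] {h : G} {a : A} (ha : a ∈ 𝒜.comp h) : a * 𝒜.proj (𝒢.s h) 1 = a := by
  have := Fintype.ofFinite G
  have h1 : 𝒜.proj h (a * (∑ g, 𝒜.proj g 1)) = a := by
    rw [sum_proj, mul_one, 𝒜.proj_of_mem ha, if_pos rfl]
  rw [Finset.mul_sum, ← projHom_apply, map_sum, Finset.sum_eq_single (𝒢.s h)] at h1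
  · rw [projHom_apply] at h1
    have := 𝒜.mul_mem _ _ (𝒢.t_s h).symm _ ha _ (𝒜.proj_mem (𝒢.s h) 1)
    rw [𝒢.mul_src] at this
    rwa [𝒜.proj_of_mem this, if_pos rfl] at h1
  · intro g _ hg
    exact 𝒜.proj_mul_right ha (𝒜.proj_mem _ _) hg
  · simp

end GpdGrading

section Lin
variable {G : Type u} {𝒢 : Gpd G} {X : Type v} {k : Type*} {A : Type w}
  [Field k] [Ring A] [Algebra k A] (α : GpdSetAction 𝒢 X) (𝒜 : GpdGrading 𝒢 k A)

@[elab_as_elim]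
lemma smash_ind {P : ((G × X) →₀ A) → Prop} {f : (G × X) →₀ A} (hf : f ∈ smashSet α 𝒜)
    (h0 : P 0) (hadd : ∀ f g, P f → P g → P (f + g))
    (hs : ∀ g x a, a ∈ 𝒜.comp g → x ∈ α.car (𝒢.s g) → P (Finsupp.single (g, x) a)) : P f := by
  rw [← f.sum_single]
  refine Finset.sum_induction _ P hadd h0 ?_
  intro p hp
  exact hs p.1 p.2 _ (hf p).1 ((hf p).2 (Finsupp.mem_support_iff.1 hp))

/-- The smash product as a submodule. -/
def smashSub : Submodule k ((G × X) →₀ A) where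
  carrier := smashSet α 𝒜
  zero_mem' := fun p => ⟨by simp, fun h => absurd rfl h⟩
  add_mem' := by
    intro a b ha hb p
    refine ⟨(𝒜.comp p.1).add_mem (ha p).1 (hb p).1, fun h => ?_⟩
    by_cases h1 : a p = 0
    · by_cases h2 : b p = 0
      · exact absurd (by simp [h1, h2]) h
      · exact (hb p).2 h2
    · exact (ha p).2 h1
  smul_mem' := by
    intro c a ha p
    refine ⟨(𝒜.comp p.1).smul_mem c (ha p).1, fun h => (ha p).2 fun h1 => h (by simp [h1])⟩

lemma mem_smashSub {f : (G × X) →₀ A} : f ∈ smashSub α 𝒜 ↔ f ∈ smashSet α 𝒜 := Iff.rfl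

lemma single_mem_smash {g : G} {x : X} {a : A} (ha : a ∈ 𝒜.comp g) (hx : x ∈ α.car (𝒢.s g)) :
    Finsupp.single (g, x) a ∈ smashSet α 𝒜 := by
  intro p
  rw [Finsupp.single_apply]
  split_ifs with h
  · subst h; exact ⟨ha, fun _ => hx⟩
  · exact ⟨Submodule.zero_mem _, fun h => absurd rfl h⟩

lemma smashMul_add_left (a b c : (G × X) →₀ A) :
    smashMul α (a + b) c = smashMul α a c + smashMul α b c := by
  unfold smashMul
  rw [Finsupp.sum_add_index']
  · intro p; simp
  · intro p x y
    rw [← Finsupp.sum_add]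
    refine Finsupp.sum_congr fun q _ => ?_
    split_ifs
    · rw [add_mul, Finsupp.single_add]
    · simp

lemma smashMul_add_right (a b c : (G × X) →₀ A) :
    smashMul α a (b + c) = smashMul α a b + smashMul α a c := by
  unfold smashMul
  rw [← Finsupp.sum_add]
  refine Finsupp.sum_congr fun p _ => ?_
  rw [Finsupp.sum_add_index']
  · intro p; simp
  · intro q x y
    split_ifs
    · rw [mul_add, Finsupp.single_add]
    · simp

lemma smashMul_zero_left (c : (G × X) →₀ A) : smashMul α 0 c = 0 := by simp [smashMul]

lemma smashMul_zero_right (c : (G × X) →₀ A) : smashMul α c 0 = 0 := by simp [smashMul]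

/-- `smashMul` as a biadditive map. -/
def smashHom : ((G × X) →₀ A) →+ ((G × X) →₀ A) →+ ((G × X) →₀ A) :=
  AddMonoidHom.mk' (fun a => AddMonoidHom.mk' (smashMul α a) (smashMul_add_right α a))
    (fun a b => AddMonoidHom.ext fun c => smashMul_add_left α a b c)

lemma smashHom_apply (a b : (G × X) →₀ A) : smashHom α a b = smashMul α a b := rfl

lemma smashMul_sum_left {ι : Type*} (s : Finset ι) (f : ι → (G × X) →₀ A) (c : (G × X) →₀ A) :
    smashMul α (∑ i ∈ s, f i) c = ∑ i ∈ s, smashMul α (f i) c := by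
  simp only [← smashHom_apply, map_sum, AddMonoidHom.finsetSum_apply]

lemma smashMul_sum_right {ι : Type*} (s : Finset ι) (f : ι → (G × X) →₀ A) (c : (G × X) →₀ A) :
    smashMul α c (∑ i ∈ s, f i) = ∑ i ∈ s, smashMul α c (f i) := by
  simp only [← smashHom_apply, map_sum]

lemma smashMul_single (p q : G × X) (a b : A) :
    smashMul α (Finsupp.single p a) (Finsupp.single q b) =
      if 𝒢.s p.1 = 𝒢.t q.1 ∧ α.act q.1 q.2 = p.2
      then Finsupp.single (𝒢.mul p.1 q.1, q.2) (a * b) else 0 := by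
  unfold smashMul
  rw [Finsupp.sum_single_index, Finsupp.sum_single_index]
  · simp
  · simp

lemma smashMul_smul_left (c : k) (a b : (G × X) →₀ A) :
    smashMul α (c • a) b = c • smashMul α a b := by
  induction a using Finsupp.induction_linear with
  | zero => simp [smashMul_zero_left]
  | add f g hf hg => rw [smul_add, smashMul_add_left, hf, hg, smashMul_add_left, smul_add]
  | single p x =>
    induction b using Finsupp.induction_linear with
    | zero => simp [smashMul_zero_right]
    | add f g hf hg => rw [smashMul_add_right, hf, hg, smashMul_add_right, smul_add]
    | single q y =>
      rw [Finsupp.smul_single, smashMul_single, smashMul_single]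
      split_ifs
      · rw [Finsupp.smul_single, smul_mul_assoc]
      · simp

lemma smashMul_smul_right (c : k) (a b : (G × X) →₀ A) :
    smashMul α a (c • b) = c • smashMul α a b := by
  induction a using Finsupp.induction_linear with
  | zero => simp [smashMul_zero_left]
  | add f g hf hg => rw [smashMul_add_left, hf, hg, smashMul_add_left, smul_add]
  | single p x =>
    induction b using Finsupp.induction_linear with
    | zero => simp [smashMul_zero_right]
    | add f g hf hg => rw [smul_add, smashMul_add_right, hf, hg, smashMul_add_right, smul_add]
    | single q y =>
      rw [Finsupp.smul_single, smashMul_single, smashMul_single]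
      split_ifs
      · rw [Finsupp.smul_single, mul_smul_comm]
      · simp

variable (β : GpdSetAction 𝒢 X)

lemma gammaAct_add (κ : G) (a b : (G × X) →₀ A) :
    gammaAct β κ (a + b) = gammaAct β κ a + gammaAct β κ b := by
  unfold gammaAct
  rw [Finsupp.sum_add_index']
  · intro p; simp
  · intro p x y
    split_ifs
    · rw [Finsupp.single_add]
    · simp

lemma gammaAct_zero (κ : G) : gammaAct β κ (0 : (G × X) →₀ A) = 0 := by simp [gammaAct]

lemma gammaAct_single (κ : G) (p : G × X) (a : A) :
    gammaAct β κ (Finsupp.single p a) =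
      if p.2 ∈ β.car (𝒢.inv κ) then Finsupp.single ((p.1, β.act κ p.2) : G × X) a else 0 := by
  unfold gammaAct
  rw [Finsupp.sum_single_index]
  simp

lemma gammaAct_sum (κ : G) {ι : Type*} (s : Finset ι) (f : ι → (G × X) →₀ A) :
    gammaAct β κ (∑ i ∈ s, f i) = ∑ i ∈ s, gammaAct β κ (f i) := by
  induction s using Finset.induction_on with
  | empty => simp [gammaAct_zero]
  | insert a s ha ih => rw [Finset.sum_insert ha, Finset.sum_insert ha, gammaAct_add, ih]

lemma gammaAct_smul (κ : G) (c : k) (a : (G × X) →₀ A) :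
    gammaAct β κ (c • a) = c • gammaAct β κ a := by
  induction a using Finsupp.induction_linear with
  | zero => simp [gammaAct_zero]
  | add f g hf hg => rw [smul_add, gammaAct_add, hf, hg, gammaAct_add, smul_add]
  | single p x =>
    rw [Finsupp.smul_single, gammaAct_single, gammaAct_single]
    split_ifs <;> simp

lemma phiStar_add [Finite X] (a b : (G × OrbT β) →₀ A) :
    phiStar α β (a + b) = phiStar α β a + phiStar α β b := by
  unfold phiStar
  rw [Finsupp.sum_add_index']
  · intro p; simp
  · intro p x y
    rw [← finsum_mem_add_distrib (Set.toFinite _)]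
    simp only [Finsupp.single_add]

lemma phiStar_zero : phiStar α β (0 : (G × OrbT β) →₀ A) = 0 := by simp [phiStar]

end Lin

set_option linter.unusedSectionVars false

section Conc
variable {G : Type u} {𝒢 : Gpd G} [Finite G] {k : Type*} {A : Type w}
  [Field k] [Ring A] [Algebra k A] (𝒜 : GpdGrading 𝒢 k A)

/-- The concrete actions of the statement. -/
structure Conc (α β : GpdSetAction 𝒢 G) (lam : GpdSetAction 𝒢 (OrbT β)) : Prop where
  a1 : ∀ g, α.car g = {h | 𝒢.t h = 𝒢.t g}
  a2 : ∀ g, ∀ h ∈ α.car (𝒢.inv g), α.act g h = 𝒢.mul g h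
  b1 : ∀ g, β.car g = {h | 𝒢.s h = 𝒢.t g}
  b2 : ∀ g, ∀ h ∈ β.car (𝒢.inv g), β.act g h = 𝒢.mul h (𝒢.inv g)
  l1 : ∀ g, lam.car g = {o : OrbT β | ∃ x ∈ α.car g, orbit β x = (o : Set G)}

variable {α β : GpdSetAction 𝒢 G} {lam : GpdSetAction 𝒢 (OrbT β)} (C : Conc α β lam)
include C

namespace Conc

lemma mem_a {g x : G} : x ∈ α.car (𝒢.s g) ↔ 𝒢.t x = 𝒢.s g := by
  rw [C.a1, Set.mem_ofPred_eq, 𝒢.t_s]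

lemma act_a {g x : G} (h : 𝒢.t x = 𝒢.s g) : α.act g x = 𝒢.mul g x := by
  apply C.a2
  rw [C.a1, Set.mem_ofPred_eq, 𝒢.t_inv, h]

lemma mem_b {κ x : G} : x ∈ β.car (𝒢.inv κ) ↔ 𝒢.s x = 𝒢.s κ := by
  rw [C.b1, Set.mem_ofPred_eq, 𝒢.t_inv]

lemma mem_b' {κ x : G} : x ∈ β.car κ ↔ 𝒢.s x = 𝒢.t κ := by
  rw [C.b1, Set.mem_ofPred_eq]

lemma act_b {κ x : G} (h : 𝒢.s x = 𝒢.s κ) : β.act κ x = 𝒢.mul x (𝒢.inv κ) :=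
  C.b2 _ _ (C.mem_b.2 h)

lemma orbit_eq (x : G) : orbit β x = {y | 𝒢.t y = 𝒢.t x} := by
  ext y
  simp only [orbit, Set.mem_ofPred_eq]
  constructor
  · rintro ⟨κ, h1, rfl⟩
    rw [C.b2 _ _ h1, 𝒢.t_mul]
    rw [𝒢.t_inv, C.mem_b.1 h1]
  · intro h
    have e1 : 𝒢.s (𝒢.inv y) = 𝒢.t x := by rw [𝒢.s_inv, h]
    have e : 𝒢.s x = 𝒢.s (𝒢.mul (𝒢.inv y) x) := by rw [𝒢.s_mul _ _ e1]
    refine ⟨𝒢.mul (𝒢.inv y) x, C.mem_b.2 e, ?_⟩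
    rw [C.act_b e]
    have h2 : 𝒢.mul y (𝒢.mul (𝒢.inv y) x) = x := 𝒢.gD h
    have h3 : 𝒢.s y = 𝒢.t (𝒢.mul (𝒢.inv y) x) := by rw [𝒢.t_mul _ _ e1, 𝒢.t_inv]
    conv_lhs => rw [← h2]
    rw [𝒢.gC h3]
    rw [𝒢.gA h3]

lemma mul_mem {f g : (G × G) →₀ A} (hf : f ∈ smashSet α 𝒜) (hg : g ∈ smashSet α 𝒜) :
    smashMul α f g ∈ smashSet α 𝒜 := by
  refine smash_ind α 𝒜 hf ?_ ?_ ?_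
  · rw [smashMul_zero_left]; exact (smashSub α 𝒜).zero_mem
  · intro a b ha hb
    rw [smashMul_add_left]; exact (smashSub α 𝒜).add_mem ha hb
  intro g1 x a ha hx
  refine smash_ind α 𝒜 hg ?_ ?_ ?_
  · rw [smashMul_zero_right]; exact (smashSub α 𝒜).zero_mem
  · intro a b ha hb
    rw [smashMul_add_right]; exact (smashSub α 𝒜).add_mem ha hb
  intro h y b hb hy
  rw [smashMul_single]
  split_ifs with hc
  · refine single_mem_smash α 𝒜 (𝒜.mul_mem _ _ hc.1 _ ha _ hb) ?_
    simpa only [𝒢.s_mul _ _ hc.1] using hy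
  · exact (smashSub α 𝒜).zero_mem

lemma mul_assoc {f g h : (G × G) →₀ A} (hf : f ∈ smashSet α 𝒜) (hg : g ∈ smashSet α 𝒜)
    (hh : h ∈ smashSet α 𝒜) :
    smashMul α (smashMul α f g) h = smashMul α f (smashMul α g h) := by
  refine smash_ind α 𝒜 hf ?_ ?_ ?_
  · simp only [smashMul_zero_left]
  · intro a b ha hb
    simp only [smashMul_add_left, ha, hb]
  intro g1 x a ha hx
  refine smash_ind α 𝒜 hg ?_ ?_ ?_
  · simp only [smashMul_zero_left, smashMul_zero_right]
  · intro a b ha hb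
    simp only [smashMul_add_left, smashMul_add_right, ha, hb]
  intro g2 y b hb hy
  refine smash_ind α 𝒜 hh ?_ ?_ ?_
  · simp only [smashMul_zero_right]
  · intro a b ha hb
    simp only [smashMul_add_right, ha, hb]
  intro g3 z c hc hz
  rw [C.mem_a] at hx hy hz
  rw [smashMul_single, smashMul_single]
  simp only
  rw [C.act_a hy, C.act_a hz]
  by_cases h23 : 𝒢.s g2 = 𝒢.t g3 ∧ 𝒢.mul g3 z = y
  · rw [if_pos h23, smashMul_single]
    obtain ⟨h1, h2⟩ := h23
    have h4 : 𝒢.t z = 𝒢.s (𝒢.mul g2 g3) := by rw [𝒢.s_mul _ _ h1, hz]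
    simp only
    rw [C.act_a h4, 𝒢.t_mul _ _ h1, 𝒢.mul_assoc _ _ _ h1 hz.symm, h2]
    by_cases h12 : 𝒢.s g1 = 𝒢.t g2 ∧ 𝒢.mul g2 y = x
    · rw [if_pos h12, if_pos h12, smashMul_single, if_pos]
      · simp only [_root_.mul_assoc, 𝒢.mul_assoc _ _ _ h12.1 h1]
      · simp only [C.act_a hz, 𝒢.s_mul _ _ h12.1]; exact ⟨h1, h2⟩
    · rw [if_neg h12, if_neg h12, smashMul_zero_left]
  · rw [if_neg h23, smashMul_zero_right]
    split_ifs with h12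
    · rw [smashMul_single, if_neg]
      simpa only [C.act_a hz, 𝒢.s_mul _ _ h12.1] using h23
    · rw [smashMul_zero_left]

lemma gamma_mem (κ : G) {f : (G × G) →₀ A} (hf : f ∈ smashSet α 𝒜) :
    gammaAct β κ f ∈ smashSet α 𝒜 := by
  refine smash_ind α 𝒜 hf ?_ ?_ ?_
  · rw [gammaAct_zero]; exact (smashSub α 𝒜).zero_mem
  · intro a b ha hb
    rw [gammaAct_add]; exact (smashSub α 𝒜).add_mem ha hb
  intro g x a ha hx
  rw [gammaAct_single]
  split_ifs with h
  · refine single_mem_smash α 𝒜 ha ?_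
    simp only at h
    have h' := C.mem_b.1 h
    rw [C.mem_a] at hx ⊢
    rw [C.act_b h', 𝒢.t_mul _ _ (by rw [𝒢.t_inv, h']), hx]
  · exact (smashSub α 𝒜).zero_mem

lemma gamma_mul (κ : G) {f g : (G × G) →₀ A} (hf : f ∈ smashSet α 𝒜) (hg : g ∈ smashSet α 𝒜) :
    gammaAct β κ (smashMul α f g) = smashMul α (gammaAct β κ f) (gammaAct β κ g) := by
  refine smash_ind α 𝒜 hf ?_ ?_ ?_
  · simp only [smashMul_zero_left, gammaAct_zero]
  · intro a b ha hb
    simp only [smashMul_add_left, gammaAct_add, ha, hb]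
  intro g1 x a ha hx
  refine smash_ind α 𝒜 hg ?_ ?_ ?_
  · simp only [smashMul_zero_right, gammaAct_zero]
  · intro a b ha hb
    simp only [smashMul_add_right, gammaAct_add, ha, hb]
  intro h y b hb hy
  rw [C.mem_a] at hx hy
  rw [smashMul_single, gammaAct_single, gammaAct_single]
  simp only [C.mem_b, C.act_a hy]
  have hs : 𝒢.s (𝒢.mul h y) = 𝒢.s y := 𝒢.s_mul _ _ hy.symm
  by_cases hyκ : 𝒢.s y = 𝒢.s κ
  · have h3 : 𝒢.s y = 𝒢.t (𝒢.inv κ) := by rw [𝒢.t_inv, hyκ]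
    have h4 : 𝒢.t (𝒢.mul y (𝒢.inv κ)) = 𝒢.s h := by rw [𝒢.t_mul _ _ h3, hy]
    rw [if_pos hyκ, C.act_b hyκ]
    by_cases hxκ : 𝒢.s x = 𝒢.s κ
    · rw [if_pos hxκ, C.act_b hxκ, smashMul_single]
      simp only
      rw [C.act_a h4, ← 𝒢.mul_assoc _ _ _ hy.symm h3]
      by_cases hc : 𝒢.s g1 = 𝒢.t h ∧ 𝒢.mul h y = x
      · rw [if_pos hc, if_pos ⟨hc.1, by rw [hc.2]⟩, gammaAct_single]
        simp only [C.mem_b, C.act_b hyκ, if_pos hyκ]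
      · rw [if_neg hc, if_neg, gammaAct_zero]
        rintro ⟨h5, h6⟩
        refine hc ⟨h5, ?_⟩
        rw [← 𝒢.gB (hs.trans hyκ), h6, 𝒢.gB hxκ]
    · rw [if_neg hxκ, smashMul_zero_left, if_neg, gammaAct_zero]
      rintro ⟨_, rfl⟩
      exact hxκ (hs.trans hyκ)
  · rw [if_neg hyκ, smashMul_zero_right]
    split_ifs
    · rw [gammaAct_single, if_neg]
      simpa only [C.mem_b] using hyκ
    · rw [gammaAct_zero]

lemma gamma_gamma (κ l : G) (f : (G × G) →₀ A) :
    gammaAct β κ (gammaAct β l f) =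
      if 𝒢.s κ = 𝒢.t l then gammaAct β (𝒢.mul κ l) f else 0 := by
  induction f using Finsupp.induction_linear with
  | zero => simp [gammaAct_zero]
  | add f g hf hg =>
    rw [gammaAct_add, gammaAct_add, hf, hg, gammaAct_add]
    split_ifs <;> simp
  | single p a =>
    obtain ⟨g, x⟩ := p
    rw [gammaAct_single, gammaAct_single]
    simp only [C.mem_b]
    by_cases hx : 𝒢.s x = 𝒢.s l
    · have h3 : 𝒢.s (β.act l x) = 𝒢.t l := by
        rw [C.act_b hx, 𝒢.s_mul _ _ (by rw [𝒢.t_inv, hx]), 𝒢.s_inv]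
      rw [if_pos hx, gammaAct_single]
      simp only [C.mem_b, h3]
      by_cases hc : 𝒢.s κ = 𝒢.t l
      · rw [if_pos hc, if_pos hc.symm, 𝒢.s_mul _ _ hc, if_pos hx,
          β.act_mul _ _ hc _ (C.mem_b.2 hx)]
      · rw [if_neg hc, if_neg (Ne.symm hc)]
    · rw [if_neg hx, gammaAct_zero]
      split_ifs with h1 h2
      · rw [𝒢.s_mul _ _ h1] at h2; exact absurd h2 hx
      · rfl
      · rfl

omit C in
/-- Explicit image of a homogeneous element under `phiStar`. -/
lemma phi_single' [Fintype G] (h : G) (o : OrbT β) (b : A) :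
    phiStar α β (Finsupp.single (h, o) b) =
      ∑ y with y ∈ α.car (𝒢.s h) ∧ orbit β y = (o : Set G), Finsupp.single (h, y) b := by
  unfold phiStar
  rw [Finsupp.sum_single_index (by simp)]
  rw [finsum_mem_eq_finite_toFinset_sum _ (Set.toFinite _)]
  refine Finset.sum_congr ?_ fun _ _ => rfl
  ext; simp

lemma phi_single [Fintype G] {h : G} {o : OrbT β} (ho : o ∈ lam.car (𝒢.s h)) (b : A) :
    phiStar α β (Finsupp.single (h, o) b) =
      ∑ y with 𝒢.t y = 𝒢.s h, Finsupp.single (h, y) b := by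
  rw [phi_single']
  refine Finset.sum_congr ?_ fun _ _ => rfl
  ext y
  simp only [Finset.mem_filter, Finset.mem_univ, true_and, C.mem_a, and_iff_left_iff_imp]
  intro hy
  rw [C.l1] at ho
  obtain ⟨x, hx, hxo⟩ := ho
  rw [← hxo, C.orbit_eq, C.orbit_eq, hy, C.mem_a.1 hx]

lemma phi_mem {w : (G × OrbT β) →₀ A} (hw : w ∈ smashSet lam 𝒜) :
    phiStar α β w ∈ smashSet α 𝒜 := by
  have := Fintype.ofFinite G
  refine smash_ind lam 𝒜 hw ?_ ?_ ?_
  · rw [phiStar_zero]; exact (smashSub α 𝒜).zero_mem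
  · intro a b ha hb
    rw [phiStar_add]; exact (smashSub α 𝒜).add_mem ha hb
  intro h o b hb ho
  rw [C.phi_single ho]
  refine (smashSub α 𝒜).sum_mem fun y hy => ?_
  exact single_mem_smash α 𝒜 hb (C.mem_a.2 (Finset.mem_filter.1 hy).2)

lemma single_phi {g x : G} {a : A} (hx : 𝒢.t x = 𝒢.s g) {h : G} {o : OrbT β}
    (ho : o ∈ lam.car (𝒢.s h)) (b : A) :
    smashMul α (Finsupp.single (g, x) a) (phiStar α β (Finsupp.single (h, o) b)) =
      if 𝒢.s g = 𝒢.t h then Finsupp.single (𝒢.mul g h, 𝒢.mul (𝒢.inv h) x) (a * b) else 0 := by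
  have := Fintype.ofFinite G
  rw [C.phi_single ho, smashMul_sum_right]
  simp only [smashMul_single]
  split_ifs with hc
  · have e : 𝒢.s (𝒢.inv h) = 𝒢.t x := by rw [𝒢.s_inv, hx, hc]
    have e1 : 𝒢.t (𝒢.mul (𝒢.inv h) x) = 𝒢.s h := by rw [𝒢.t_mul _ _ e, 𝒢.t_inv]
    rw [Finset.sum_eq_single (𝒢.mul (𝒢.inv h) x)]
    · rw [if_pos]
      refine ⟨hc, ?_⟩
      rw [C.act_a e1, 𝒢.gD (by rw [hx, hc])]
    · intro y hy hne
      have hy' := (Finset.mem_filter.1 hy).2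
      rw [if_neg]
      rintro ⟨_, h2⟩
      rw [C.act_a hy'] at h2
      apply hne
      rw [← h2, 𝒢.gC hy'.symm]
    · intro hn
      exact absurd (by simpa using e1) hn
  · refine Finset.sum_eq_zero fun y _ => ?_
    rw [if_neg (fun h => hc h.1)]

lemma gamma_phi (κ : G) {f : (G × G) →₀ A} {w : (G × OrbT β) →₀ A} (hf : f ∈ smashSet α 𝒜)
    (hw : w ∈ smashSet lam 𝒜) :
    gammaAct β κ (smashMul α f (phiStar α β w)) = smashMul α (gammaAct β κ f) (phiStar α β w) := by
  refine smash_ind α 𝒜 hf ?_ ?_ ?_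
  · simp only [smashMul_zero_left, gammaAct_zero]
  · intro a b ha hb
    simp only [smashMul_add_left, gammaAct_add, ha, hb]
  intro g x a ha hx
  refine smash_ind lam 𝒜 hw ?_ ?_ ?_
  · simp only [smashMul_zero_right, gammaAct_zero, phiStar_zero]
  · intro a b ha hb
    simp only [smashMul_add_right, gammaAct_add, phiStar_add, ha, hb]
  intro h o b hb ho
  rw [C.mem_a] at hx
  rw [C.single_phi hx ho, gammaAct_single]
  simp only [C.mem_b]
  by_cases hxκ : 𝒢.s x = 𝒢.s κ
  · have h3 : 𝒢.s x = 𝒢.t (𝒢.inv κ) := by rw [𝒢.t_inv, hxκ]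
    rw [if_pos hxκ, C.act_b hxκ, C.single_phi (by rw [𝒢.t_mul _ _ h3, hx]) ho]
    split_ifs with hc
    · have e : 𝒢.s (𝒢.inv h) = 𝒢.t x := by rw [𝒢.s_inv, hx, hc]
      have e2 : 𝒢.s (𝒢.mul (𝒢.inv h) x) = 𝒢.s κ := by rw [𝒢.s_mul _ _ e, hxκ]
      rw [gammaAct_single]
      simp only [C.mem_b]
      rw [if_pos e2, C.act_b e2, 𝒢.mul_assoc _ _ _ e h3]
    · rw [gammaAct_zero]
  · rw [if_neg hxκ, smashMul_zero_left]
    split_ifs with hc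
    · have e : 𝒢.s (𝒢.inv h) = 𝒢.t x := by rw [𝒢.s_inv, hx, hc]
      rw [gammaAct_single, if_neg]
      simp only [C.mem_b]
      rwa [𝒢.s_mul _ _ e]
    · rw [gammaAct_zero]

end Conc
end Conc

section Weak
variable {G : Type u} {𝒢 : Gpd G} [Finite G] {k : Type*} {A : Type w}
  [Field k] [Ring A] [Algebra k A] (𝒜 : GpdGrading 𝒢 k A)

lemma weakToSmash_apply (F : G →₀ A) (g h : G) : weakToSmash 𝒜 F (g, h) = 𝒜.proj g (F h) := by
  have := Fintype.ofFinite G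
  unfold weakToSmash
  rw [Finsupp.sum_fintype _ _ (fun i => by simp [𝒜.proj_zero])]
  simp only [finsum_eq_sum_of_fintype, Finsupp.finsetSum_apply, Finsupp.single_apply,
    Prod.mk.injEq]
  rw [Finset.sum_eq_single h, Finset.sum_eq_single g]
  · simp
  · intro b _ hb; simp [hb]
  · simp
  · intro b _ hb; simp [hb]
  · simp

lemma weakToSmash_add (F F' : G →₀ A) :
    weakToSmash 𝒜 (F + F') = weakToSmash 𝒜 F + weakToSmash 𝒜 F' := by
  ext ⟨g, h⟩
  simp [weakToSmash_apply, 𝒜.proj_add]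

lemma weakToSmash_zero : weakToSmash 𝒜 (0 : G →₀ A) = 0 := by
  ext ⟨g, h⟩
  simp [weakToSmash_apply, 𝒜.proj_zero]

lemma weakToSmash_single {g h : G} {a : A} (ha : a ∈ 𝒜.comp g) :
    weakToSmash 𝒜 (Finsupp.single h a) = Finsupp.single (g, h) a := by
  ext ⟨g', h'⟩
  rw [weakToSmash_apply, Finsupp.single_apply, Finsupp.single_apply]
  by_cases e : h = h'
  · rw [if_pos e, 𝒜.proj_of_mem ha]
    by_cases e' : g' = g
    · rw [if_pos e', if_pos (by rw [e, e'])]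
    · rw [if_neg e', if_neg (by simp [Ne.symm e'])]
  · rw [if_neg e, 𝒜.proj_zero, if_neg (by simp [e])]

@[elab_as_elim]
lemma weak_ind {P : (G →₀ A) → Prop} {F : G →₀ A} (hF : F ∈ weakSmashSet 𝒜)
    (h0 : P 0) (hadd : ∀ f g, P f → P g → P (f + g))
    (hs : ∀ g h a, a ∈ 𝒜.comp g → 𝒢.s g = 𝒢.t h → P (Finsupp.single h a)) : P F := by
  have := Fintype.ofFinite G
  rw [← F.sum_single]
  refine Finset.sum_induction _ P hadd h0 ?_
  intro h _
  have e : Finsupp.single h (F h) = ∑ g, Finsupp.single h (𝒜.proj g (F h)) := by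
    rw [← Finsupp.single_finsetSum, 𝒜.sum_proj]
  rw [e]
  refine Finset.sum_induction _ P hadd h0 ?_
  intro g _
  by_cases hz : 𝒜.proj g (F h) = 0
  · rw [hz, Finsupp.single_zero]; exact h0
  · exact hs g h _ (𝒜.proj_mem _ _) (hF h g hz)

lemma weakSmashMul_add_right (a b c : G →₀ A) :
    weakSmashMul 𝒜 a (b + c) = weakSmashMul 𝒜 a b + weakSmashMul 𝒜 a c := by
  unfold weakSmashMul
  rw [Finsupp.sum_add_index']
  · intro p; simp [𝒜.proj_zero]
  · intro p x y
    rw [← Finsupp.sum_add]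
    refine Finsupp.sum_congr fun q _ => ?_
    split_ifs
    · rw [𝒜.proj_add, mul_add, Finsupp.single_add]
    · simp

lemma weakSmashMul_add_left (a b c : G →₀ A) :
    weakSmashMul 𝒜 (a + b) c = weakSmashMul 𝒜 a c + weakSmashMul 𝒜 b c := by
  unfold weakSmashMul
  rw [← Finsupp.sum_add]
  refine Finsupp.sum_congr fun p _ => ?_
  rw [Finsupp.sum_add_index']
  · intro p; simp
  · intro q x y
    split_ifs
    · rw [add_mul, Finsupp.single_add]
    · simp

lemma weakSmashMul_zero_left (c : G →₀ A) : weakSmashMul 𝒜 0 c = 0 := by simp [weakSmashMul]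

lemma weakSmashMul_zero_right (c : G →₀ A) : weakSmashMul 𝒜 c 0 = 0 := by simp [weakSmashMul]

lemma weakSmashMul_single (h l : G) (a b : A) :
    weakSmashMul 𝒜 (Finsupp.single h a) (Finsupp.single l b) =
      if 𝒢.s h = 𝒢.s l then Finsupp.single l (a * 𝒜.proj (𝒢.mul h (𝒢.inv l)) b) else 0 := by
  unfold weakSmashMul
  rw [Finsupp.sum_single_index, Finsupp.sum_single_index]
  · simp
  · simp [𝒜.proj_zero]

variable {α β : GpdSetAction 𝒢 G} {lam : GpdSetAction 𝒢 (OrbT β)} (C : Conc α β lam)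
include C

lemma Conc.weak_bij : Set.BijOn (weakToSmash 𝒜) (weakSmashSet 𝒜) (smashSet α 𝒜) := by
  have := Fintype.ofFinite G
  refine ⟨?_, ?_, ?_⟩
  · intro F hF
    rintro ⟨g, h⟩
    rw [weakToSmash_apply]
    refine ⟨𝒜.proj_mem _ _, fun hn => ?_⟩
    simp only [C.mem_a]
    exact (hF h g hn).symm
  · intro F _ F' _ e
    ext h
    rw [← 𝒜.sum_proj (F h), ← 𝒜.sum_proj (F' h)]
    refine Finset.sum_congr rfl fun g _ => ?_
    rw [← weakToSmash_apply, e, weakToSmash_apply]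
  · intro f hf
    have key : ∀ g h : G, 𝒜.proj g (∑ g', f (g', h)) = f (g, h) := by
      intro g h
      rw [← 𝒜.projHom_apply, map_sum, Finset.sum_eq_single g]
      · rw [𝒜.projHom_apply, 𝒜.proj_of_mem (hf (g, h)).1, if_pos rfl]
      · intro b _ hb
        rw [𝒜.projHom_apply, 𝒜.proj_of_mem (hf (b, h)).1, if_neg (Ne.symm hb)]
      · simp
    refine ⟨Finsupp.equivFunOnFinite.symm fun h => ∑ g', f (g', h), ?_, ?_⟩
    · intro h g hn
      simp only [Finsupp.equivFunOnFinite_symm_apply_apply, key] at hn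
      exact (C.mem_a.1 ((hf (g, h)).2 hn)).symm
    · ext ⟨g, h⟩
      rw [weakToSmash_apply, Finsupp.equivFunOnFinite_symm_apply_apply, key]

lemma Conc.weak_mul {F₁ F₂ : G →₀ A} (h₁ : F₁ ∈ weakSmashSet 𝒜) (h₂ : F₂ ∈ weakSmashSet 𝒜) :
    weakToSmash 𝒜 (weakSmashMul 𝒜 F₁ F₂)
        = smashMul α (weakToSmash 𝒜 F₁) (weakToSmash 𝒜 F₂) := by
  refine weak_ind 𝒜 h₁ ?_ ?_ ?_
  · simp only [weakSmashMul_zero_left, smashMul_zero_left, weakToSmash_zero]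
  · intro f g hf hg
    simp only [weakSmashMul_add_left, smashMul_add_left, weakToSmash_add, hf, hg]
  intro g h a ha hgh
  refine weak_ind 𝒜 h₂ ?_ ?_ ?_
  · simp only [weakSmashMul_zero_right, smashMul_zero_right, weakToSmash_zero]
  · intro f g hf hg
    simp only [weakSmashMul_add_right, smashMul_add_right, weakToSmash_add, hf, hg]
  intro m l b hb hml
  rw [weakSmashMul_single, weakToSmash_single 𝒜 ha, weakToSmash_single 𝒜 hb, smashMul_single]
  simp only
  rw [C.act_a hml.symm, 𝒜.proj_of_mem hb]
  by_cases hc : 𝒢.mul m l = h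
  · have e1 : 𝒢.s h = 𝒢.s l := by rw [← hc, 𝒢.s_mul _ _ hml]
    have e2 : 𝒢.s g = 𝒢.t m := by rw [hgh, ← hc, 𝒢.t_mul _ _ hml]
    have e3 : 𝒢.mul h (𝒢.inv l) = m := by rw [← hc, 𝒢.gA hml]
    rw [if_pos e1, if_pos e3, if_pos ⟨e2, hc⟩,
      weakToSmash_single 𝒜 (𝒜.mul_mem _ _ e2 _ ha _ hb)]
  · have hn : ¬ (𝒢.s g = 𝒢.t m ∧ 𝒢.mul m l = h) := fun h' => hc h'.2
    rw [if_neg hn]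
    split_ifs with e1 e2
    · exact absurd (by rw [← e2, 𝒢.gB e1]) hc
    · rw [mul_zero, Finsupp.single_zero, weakToSmash_zero]
    · rw [weakToSmash_zero]

end Weak

section Dual
variable {G : Type u} {𝒢 : Gpd G} [Finite G] {k : Type*} {A : Type w}
  [Field k] [Ring A] [Algebra k A] (𝒜 : GpdGrading 𝒢 k A)

/-- The duality map. -/
def PsiMap (α β : GpdSetAction 𝒢 G) (F : G →₀ ((G × G) →₀ A)) (f : (G × G) →₀ A) :
    (G × G) →₀ A :=
  F.sum fun κ x => smashMul α x (gammaAct β κ f)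

lemma Psi_eq [Fintype G] (α β : GpdSetAction 𝒢 G) (F : G →₀ ((G × G) →₀ A)) (f : (G × G) →₀ A) :
    PsiMap α β F f = ∑ κ, smashMul α (F κ) (gammaAct β κ f) := by
  unfold PsiMap
  rw [Finsupp.sum_fintype]
  intro i
  exact smashMul_zero_left _ _

lemma Psi_add (α β : GpdSetAction 𝒢 G) (F F' : G →₀ ((G × G) →₀ A)) (f : (G × G) →₀ A) :
    PsiMap α β (F + F') f = PsiMap α β F f + PsiMap α β F' f := by
  have := Fintype.ofFinite G
  simp only [Psi_eq, Finsupp.add_apply, smashMul_add_left, Finset.sum_add_distrib]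

lemma Psi_zero (α β : GpdSetAction 𝒢 G) (f : (G × G) →₀ A) :
    PsiMap α β 0 f = 0 := by simp [PsiMap]

lemma Psi_single (α β : GpdSetAction 𝒢 G) (κ : G) (x f : (G × G) →₀ A) :
    PsiMap α β (Finsupp.single κ x) f = smashMul α x (gammaAct β κ f) := by
  unfold PsiMap
  rw [Finsupp.sum_single_index]
  exact smashMul_zero_left _ _

lemma Psi_sum (α β : GpdSetAction 𝒢 G) {ι : Type*} (s : Finset ι)
    (F : ι → G →₀ ((G × G) →₀ A)) (f : (G × G) →₀ A) :
    PsiMap α β (∑ i ∈ s, F i) f = ∑ i ∈ s, PsiMap α β (F i) f := by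
  induction s using Finset.induction_on with
  | empty => simp [Psi_zero]
  | insert a s ha ih => rw [Finset.sum_insert ha, Finset.sum_insert ha, Psi_add, ih]

/-- Diagonal idempotents. -/
def EE (r : G) : (G × G) →₀ A := Finsupp.single (𝒢.t r, r) (𝒜.proj (𝒢.t r) 1)

variable {α β : GpdSetAction 𝒢 G} {lam : GpdSetAction 𝒢 (OrbT β)} (C : Conc α β lam)
include C

namespace Conc

lemma EE_mem (r : G) : EE 𝒜 r ∈ smashSet α 𝒜 :=
  single_mem_smash α 𝒜 (𝒜.proj_mem _ _) (C.mem_a.2 (𝒢.s_t r).symm)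

lemma gamma_EE (κ r : G) : gammaAct β κ (EE 𝒜 r) =
    if 𝒢.s r = 𝒢.s κ then EE 𝒜 (𝒢.mul r (𝒢.inv κ)) else 0 := by
  unfold EE
  rw [gammaAct_single]
  simp only [C.mem_b]
  split_ifs with h
  · rw [C.act_b h, 𝒢.t_mul _ _ (by rw [𝒢.t_inv, h])]
  · rfl

lemma mul_EE {f : (G × G) →₀ A} (hf : f ∈ smashSet α 𝒜) (z : G) (p : G × G) :
    smashMul α f (EE 𝒜 z) p = if p.2 = z then f p else 0 := by
  refine smash_ind α 𝒜 hf ?_ ?_ ?_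
  · simp [smashMul_zero_left]
  · intro a b ha hb
    rw [smashMul_add_left, Finsupp.add_apply, ha, hb]
    split_ifs <;> simp
  intro g x a ha hx
  rw [C.mem_a] at hx
  unfold EE
  rw [smashMul_single]
  simp only
  rw [C.act_a (𝒢.s_t z).symm, 𝒢.t_t, 𝒢.tgt_mul]
  by_cases hz : z = x
  · subst hz
    rw [if_pos ⟨hx.symm, rfl⟩, hx, 𝒢.mul_src, 𝒜.mul_unit ha, Finsupp.single_apply]
    by_cases hp : (g, z) = p
    · subst hp; simp
    · rw [if_neg hp]; simp
  · rw [if_neg (fun h => hz h.2), Finsupp.single_apply]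
    by_cases hp : (g, x) = p
    · subst hp; simp [Ne.symm hz]
    · rw [if_neg hp]; simp

omit [Finite G] C in
lemma idx {r κ y : G} : (𝒢.s r = 𝒢.s κ ∧ y = 𝒢.mul r (𝒢.inv κ)) ↔
    (𝒢.t y = 𝒢.t r ∧ κ = 𝒢.mul (𝒢.inv y) r) := by
  constructor
  · rintro ⟨h, rfl⟩
    have h1 : 𝒢.s r = 𝒢.t (𝒢.inv κ) := by rw [𝒢.t_inv, h]
    refine ⟨𝒢.t_mul _ _ h1, ?_⟩
    have h2 := 𝒢.gB h
    have h3 : 𝒢.s (𝒢.mul r (𝒢.inv κ)) = 𝒢.t κ := by rw [𝒢.s_mul _ _ h1, 𝒢.s_inv]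
    have h4 := 𝒢.gC h3
    rw [h2] at h4
    exact h4.symm
  · rintro ⟨h, rfl⟩
    have h1 : 𝒢.s (𝒢.inv y) = 𝒢.t r := by rw [𝒢.s_inv, h]
    refine ⟨(𝒢.s_mul _ _ h1).symm, ?_⟩
    have h2 := 𝒢.gD h
    have h3 : 𝒢.s y = 𝒢.t (𝒢.mul (𝒢.inv y) r) := by rw [𝒢.t_mul _ _ h1, 𝒢.t_inv]
    have h4 := 𝒢.gA h3
    rw [h2] at h4
    exact h4.symm

lemma Psi_EE {F : G →₀ ((G × G) →₀ A)} (hF : F ∈ skewSet α β 𝒜) (r h y : G) :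
    PsiMap α β F (EE 𝒜 r) (h, y) =
      if 𝒢.t y = 𝒢.t r then F (𝒢.mul (𝒢.inv y) r) (h, y) else 0 := by
  have := Fintype.ofFinite G
  rw [Psi_eq, Finsupp.finsetSum_apply]
  have : ∀ κ, smashMul α (F κ) (gammaAct β κ (EE 𝒜 r)) (h, y) =
      if 𝒢.t y = 𝒢.t r ∧ κ = 𝒢.mul (𝒢.inv y) r then F κ (h, y) else 0 := by
    intro κ
    simp only [← idx]
    rw [C.gamma_EE]
    by_cases h1 : 𝒢.s r = 𝒢.s κ
    · rw [if_pos h1, C.mul_EE 𝒜 (hF κ).1]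
      simp [h1]
    · rw [if_neg h1, smashMul_zero_right, if_neg (fun h => h1 h.1)]; rfl
  simp only [this]
  by_cases h1 : 𝒢.t y = 𝒢.t r
  · simp [h1]
  · simp [h1]

lemma Psi_rmod {F : G →₀ ((G × G) →₀ A)} (hF : F ∈ skewSet α β 𝒜) :
    IsRModEnd α β 𝒜 lam (PsiMap α β F) := by
  have := Fintype.ofFinite G
  refine ⟨?_, ?_, ?_, ?_⟩
  · intro f hf
    rw [Psi_eq]
    exact (smashSub α 𝒜).sum_mem fun κ _ => C.mul_mem 𝒜 (hF κ).1 (C.gamma_mem 𝒜 κ hf)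
  · intro f _ g _
    simp only [Psi_eq, gammaAct_add, smashMul_add_right, Finset.sum_add_distrib]
  · intro c f _
    simp only [Psi_eq, gammaAct_smul, smashMul_smul_right, Finset.smul_sum]
  · intro f hf w hw
    rw [Psi_eq, Psi_eq, smashMul_sum_left]
    refine Finset.sum_congr rfl fun κ _ => ?_
    rw [C.gamma_phi 𝒜 κ hf hw, C.mul_assoc 𝒜 (hF κ).1 (C.gamma_mem 𝒜 κ hf) (C.phi_mem 𝒜 hw)]

lemma Psi_mul {F₁ F₂ : G →₀ ((G × G) →₀ A)} (h₁ : F₁ ∈ skewSet α β 𝒜) (h₂ : F₂ ∈ skewSet α β 𝒜)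
    {f : (G × G) →₀ A} (hf : f ∈ smashSet α 𝒜) :
    PsiMap α β (skewMul α β F₁ F₂) f = PsiMap α β F₁ (PsiMap α β F₂ f) := by
  unfold skewMul
  rw [Finsupp.sum, Psi_sum]
  conv_rhs => rw [PsiMap, Finsupp.sum]
  refine Finset.sum_congr rfl fun κ _ => ?_
  rw [Finsupp.sum, Psi_sum, PsiMap, Finsupp.sum, gammaAct_sum, smashMul_sum_right]
  refine Finset.sum_congr rfl fun l _ => ?_
  have hl := C.gamma_mem 𝒜 l hf
  rw [C.gamma_mul 𝒜 κ (h₂ l).1 hl,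
    ← C.mul_assoc 𝒜 (h₁ κ).1 (C.gamma_mem 𝒜 κ (h₂ l).1) (C.gamma_mem 𝒜 κ hl), C.gamma_gamma]
  split_ifs
  · rw [Psi_single]
  · rw [Psi_zero, smashMul_zero_right]

lemma Psi_inj {F₁ F₂ : G →₀ ((G × G) →₀ A)} (h₁ : F₁ ∈ skewSet α β 𝒜) (h₂ : F₂ ∈ skewSet α β 𝒜)
    (h : ∀ f ∈ smashSet α 𝒜, PsiMap α β F₁ f = PsiMap α β F₂ f) : F₁ = F₂ := by
  ext κ ⟨g, y⟩
  by_cases hy : 𝒢.s y = 𝒢.t κ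
  · have e := DFunLike.congr_fun (h _ (C.EE_mem 𝒜 (𝒢.mul y κ))) (g, y)
    rw [C.Psi_EE 𝒜 h₁, C.Psi_EE 𝒜 h₂, 𝒢.gC hy, if_pos (𝒢.t_mul _ _ hy).symm,
      if_pos (𝒢.t_mul _ _ hy).symm] at e
    exact e
  · have key : ∀ F ∈ skewSet α β 𝒜, F κ (g, y) = 0 := by
      intro F hF
      by_contra hn
      exact hy (C.mem_b'.1 ((hF κ).2 _ hn))
    rw [key _ h₁, key _ h₂]

lemma orb_mem {g x : G} (h : 𝒢.t x = 𝒢.s g) : orbMap β x ∈ lam.car (𝒢.s g) := by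
  rw [C.l1]
  exact ⟨x, C.mem_a.2 h, rfl⟩

/-- The homogeneous elements of the coefficient algebra generating the module. -/
lemma EE_phi {g x : G} {a : A} (ha : a ∈ 𝒜.comp g) (hx : 𝒢.t x = 𝒢.s g) :
    smashMul α (EE 𝒜 (𝒢.mul g x)) (phiStar α β (Finsupp.single (g, orbMap β x) a)) =
      Finsupp.single (g, x) a := by
  unfold EE
  have h1 : 𝒢.t (𝒢.mul g x) = 𝒢.t g := 𝒢.t_mul _ _ hx.symm
  rw [C.single_phi (by rw [𝒢.s_t]) (C.orb_mem hx), h1, if_pos (𝒢.s_t g), 𝒢.tgt_mul,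
    𝒢.gC hx.symm, 𝒜.unit_mul ha]

lemma mul_phi_unit {f : (G × G) →₀ A} (hf : f ∈ smashSet α 𝒜) (r : G) (p : G × G) :
    smashMul α f (phiStar α β (Finsupp.single (𝒢.t r, orbMap β r) (𝒜.proj (𝒢.t r) 1))) p =
      if 𝒢.t p.2 = 𝒢.t r then f p else 0 := by
  refine smash_ind α 𝒜 hf ?_ ?_ ?_
  · simp [smashMul_zero_left]
  · intro a b ha hb
    rw [smashMul_add_left, Finsupp.add_apply, ha, hb]
    split_ifs <;> simp
  intro g x a ha hx
  rw [C.mem_a] at hx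
  rw [C.single_phi hx (C.orb_mem (𝒢.s_t r).symm), 𝒢.t_t]
  by_cases hc : 𝒢.s g = 𝒢.t r
  · have h1 : 𝒢.mul (𝒢.inv (𝒢.t r)) x = x := by
      have h2 := 𝒢.gC (h := 𝒢.t x) (𝒢.s_t x)
      rwa [𝒢.tgt_mul, hx, hc] at h2
    rw [if_pos hc, h1, ← hc, 𝒢.mul_src, 𝒜.mul_unit ha, Finsupp.single_apply]
    by_cases hp : (g, x) = p
    · subst hp; simp [hx]
    · rw [if_neg hp]; simp
  · rw [if_neg hc, Finsupp.single_apply]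
    by_cases hp : (g, x) = p
    · subst hp
      rw [if_neg]
      · rfl
      · simpa [hx] using hc
    · rw [if_neg hp]; simp

lemma rmod_ext {F F' : ((G × G) →₀ A) → ((G × G) →₀ A)} (hF : IsRModEnd α β 𝒜 lam F)
    (hF' : IsRModEnd α β 𝒜 lam F') (h : ∀ r, F (EE 𝒜 r) = F' (EE 𝒜 r))
    {f : (G × G) →₀ A} (hf : f ∈ smashSet α 𝒜) : F f = F' f := by
  have z : ∀ {F : ((G × G) →₀ A) → ((G × G) →₀ A)}, IsRModEnd α β 𝒜 lam F → F 0 = 0 := by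
    intro F hF
    have := hF.2.2.1 0 0 (smashSub α 𝒜).zero_mem
    simpa using this
  suffices f ∈ smashSet α 𝒜 ∧ F f = F' f from this.2
  refine smash_ind α 𝒜 hf ?_ ?_ ?_
  · exact ⟨(smashSub α 𝒜).zero_mem, by rw [z hF, z hF']⟩
  · rintro a b ⟨ha, ha'⟩ ⟨hb, hb'⟩
    exact ⟨(smashSub α 𝒜).add_mem ha hb, by
      rw [hF.2.1 _ ha _ hb, hF'.2.1 _ ha _ hb, ha', hb']⟩
  intro g x a ha hx
  refine ⟨single_mem_smash α 𝒜 ha hx, ?_⟩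
  rw [C.mem_a] at hx
  have hw := single_mem_smash lam 𝒜 ha (C.orb_mem hx)
  rw [← C.EE_phi 𝒜 ha hx, hF.2.2.2 _ (C.EE_mem 𝒜 _) _ hw, hF'.2.2.2 _ (C.EE_mem 𝒜 _) _ hw, h]

lemma Psi_surj {F : ((G × G) →₀ A) → ((G × G) →₀ A)} (hF : IsRModEnd α β 𝒜 lam F) :
    ∃ Fs ∈ skewSet α β 𝒜, ∀ f ∈ smashSet α 𝒜, PsiMap α β Fs f = F f := by
  let Fs : G →₀ ((G × G) →₀ A) := Finsupp.equivFunOnFinite.symm fun κ =>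
    Finsupp.equivFunOnFinite.symm fun p =>
      if 𝒢.s p.2 = 𝒢.t κ then F (EE 𝒜 (𝒢.mul p.2 κ)) p else 0
  have hFs : ∀ κ p, Fs κ p = if 𝒢.s p.2 = 𝒢.t κ then F (EE 𝒜 (𝒢.mul p.2 κ)) p else 0 :=
    fun κ p => by simp [Fs]
  have hm : Fs ∈ skewSet α β 𝒜 := by
    intro κ
    refine ⟨fun p => ?_, fun p => ?_⟩
    · rw [hFs]
      split_ifs
      · exact hF.1 _ (C.EE_mem 𝒜 _) p
      · exact ⟨Submodule.zero_mem _, fun h => absurd rfl h⟩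
    · rw [hFs]
      split_ifs with h
      · intro _; exact C.mem_b'.2 h
      · intro h; exact absurd rfl h
  refine ⟨Fs, hm, fun f hf => ?_⟩
  refine C.rmod_ext 𝒜 (C.Psi_rmod 𝒜 hm) hF ?_ hf
  intro r
  ext ⟨h, y⟩
  rw [C.Psi_EE 𝒜 hm, hFs]
  simp only
  split_ifs with h1 h2
  · rw [𝒢.gD h1]
  · exact absurd (by rw [𝒢.t_mul _ _ (by rw [𝒢.s_inv, h1]), 𝒢.t_inv]) h2
  · have hw := single_mem_smash lam 𝒜 (𝒜.proj_mem (𝒢.t r) 1) (C.orb_mem (𝒢.s_t r).symm)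
    have e := hF.2.2.2 _ (C.EE_mem 𝒜 r) _ hw
    have e2 : smashMul α (EE 𝒜 r)
        (phiStar α β (Finsupp.single (𝒢.t r, orbMap β r) (𝒜.proj (𝒢.t r) 1))) = EE 𝒜 r := by
      have := C.EE_phi 𝒜 (𝒜.proj_mem (𝒢.t r) 1) (𝒢.s_t r).symm
      rwa [𝒢.tgt_mul] at this
    rw [e2] at e
    rw [e, C.mul_phi_unit 𝒜 (hF.1 _ (C.EE_mem 𝒜 r)), if_neg h1]

lemma duality : SmashDuality k α β 𝒜 lam := by
  have := Fintype.ofFinite G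
  refine ⟨PsiMap α β, fun F hF => C.Psi_rmod 𝒜 hF, fun F₁ _ F₂ _ f _ => Psi_add α β F₁ F₂ f, ?_,
    fun F₁ h₁ F₂ h₂ f hf => C.Psi_mul 𝒜 h₁ h₂ hf, fun F₁ h₁ F₂ h₂ h => C.Psi_inj 𝒜 h₁ h₂ h,
    fun F hF => C.Psi_surj 𝒜 hF⟩
  intro c F _ f _
  simp only [Psi_eq, Finsupp.smul_apply, smashMul_smul_left, Finset.smul_sum]

end Conc
end Dual

end Helpers

/-- Let `𝒢` be a finite groupoid and `A` a unital
`𝒢`-graded algebra.  Then `(A # k𝒢*) *_γ 𝒢 ≅ End((A # k𝒢*)_{A #_λ^𝒢 O^𝒢})`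
as algebras, where `X = {v_g : g ∈ 𝒢}` is the split `(𝒢_α, 𝒢_β)`-set with
`α_g(v_h) = v_{gh}` and `β_g(v_h) = v_{h g⁻¹}`, the weak smash product
`A # k𝒢*` is identified with `A #_α^𝒢 X` via the isomorphism `ψ`, `γ` is the
induced action of `𝒢` on it, and `O^𝒢` is the set of `β`-orbits with its
induced `𝒢`-action `λ`. -/
theorem weak_smash_duality
    {G : Type u} (𝒢 : Gpd G) [Finite G]
    (k : Type*) (A : Type w) [Field k] [Ring A] [Algebra k A]
    (𝒜 : GpdGrading 𝒢 k A)
    -- `α` is the action of `𝒢` on `X = {v_g : g ∈ 𝒢}` by `α_g(v_h) = v_{gh}`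
    (α : GpdSetAction 𝒢 G)
    (hα₁ : ∀ g, α.car g = {h | 𝒢.t h = 𝒢.t g})
    (hα₂ : ∀ g, ∀ h ∈ α.car (𝒢.inv g), α.act g h = 𝒢.mul g h)
    -- `β` is the action of `𝒢` on `X` by `β_g(v_h) = v_{h g⁻¹}`
    (β : GpdSetAction 𝒢 G)
    (hβ₁ : ∀ g, β.car g = {h | 𝒢.s h = 𝒢.t g})
    (hβ₂ : ∀ g, ∀ h ∈ β.car (𝒢.inv g), β.act g h = 𝒢.mul h (𝒢.inv g))
    -- `λ` is the induced `𝒢`-action on the orbit set `O^𝒢`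
    (lam : GpdSetAction 𝒢 (OrbT β))
    (hlam₁ : ∀ g, lam.car g = {o : OrbT β | ∃ x ∈ α.car g, orbit β x = (o : Set G)})
    (hlam₂ : ∀ g, ∀ x ∈ α.car (𝒢.inv g), lam.act g (orbMap β x) = orbMap β (α.act g x)) :
    -- the weak smash product `A # k𝒢*` is identified with `A #_α^𝒢 X` via `ψ`
    Set.BijOn (weakToSmash 𝒜) (weakSmashSet 𝒜) (smashSet α 𝒜) ∧
    (∀ F₁ ∈ weakSmashSet 𝒜, ∀ F₂ ∈ weakSmashSet 𝒜,
      weakToSmash 𝒜 (weakSmashMul 𝒜 F₁ F₂)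
        = smashMul α (weakToSmash 𝒜 F₁) (weakToSmash 𝒜 F₂)) ∧
    -- and under this identification the duality isomorphism
    -- `(A # k𝒢*) *_γ 𝒢 ≅ End((A # k𝒢*)_{A #_λ^𝒢 O^𝒢})` holds
    SmashDuality k α β 𝒜 lam := by
  have C : Conc α β lam := ⟨hα₁, hα₂, hβ₁, hβ₂, hlam₁⟩
  exact ⟨C.weak_bij 𝒜, fun F₁ h₁ F₂ h₂ => C.weak_mul 𝒜 h₁ h₂, C.duality 𝒜⟩

end
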